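/- Let α, β be distinct nonzero elements of a field K and M = (αI_p + N) ⊕ (βI_q + N') with N² = 0, (N')² = 0. If M = αA + βB with A, B idempotent, then there exist matrices X ∈ Mat_{p,q}(K) and Y ∈ Mat_{q,p}(K) with N = XY and −N' = YX. -/

import Mathlib

theorem aux_sylv {K : Type*} [Field K] {p : ℕ} (δ : K) (hδ : δ ≠ 0)
    (N e : Matrix (Fin p) (Fin p) K) (hN : N * N = 0)
    (h : δ • e + N * e + e * N = 0) : e = 0 := by
  have hN2 : ∀ x : Matrix (Fin p) (Fin p) K, N * (N * x) = 0 := by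
    intro x; rw [← mul_assoc, hN, zero_mul]
  have h1 : N * (e * N) = 0 := by
    have := congrArg (fun x => N * x * N) h
    simpa [mul_add, add_mul, mul_assoc, hN, hN2, hδ] using this
  have h2 : N * e = 0 := by
    have := congrArg (fun x => N * x) h
    simpa [mul_add, hN2, h1, hδ] using this
  have h3 : e * N = 0 := by
    have := congrArg (fun x => x * N) h
    simpa [add_mul, mul_assoc, hN, h1, hδ] using this
  simpa [h2, h3, hδ] using h

theorem stmt_18 {K : Type*} [Field K] {p q : ℕ} (α β : K) (hα : α ≠ 0) (hβ : β ≠ 0)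
    (hαβ : α ≠ β) (N : Matrix (Fin p) (Fin p) K) (N' : Matrix (Fin q) (Fin q) K)
    (hN : N ^ 2 = 0) (hN' : N' ^ 2 = 0)
    (A B : Matrix (Fin p ⊕ Fin q) (Fin p ⊕ Fin q) K) (hA : A ^ 2 = A) (hB : B ^ 2 = B)
    (hM : Matrix.fromBlocks (α • 1 + N) 0 0 (β • 1 + N') = α • A + β • B) :
    ∃ (X : Matrix (Fin p) (Fin q) K) (Y : Matrix (Fin q) (Fin p) K),
      N = X * Y ∧ -N' = Y * X := by
  have hδ : α - β ≠ 0 := sub_ne_zero.mpr hαβ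
  rw [pow_two] at hN hN' hA hB
  obtain ⟨P, hP⟩ : ∃ P, P = α • A := ⟨_, rfl⟩
  obtain ⟨M, hMd⟩ : ∃ M, M = Matrix.fromBlocks (α • 1 + N) 0 0 (β • 1 + N') := ⟨_, rfl⟩
  have hPP : P * P = α • P := by
    rw [hP, smul_mul_smul_comm, hA, smul_smul]
  have hQ : β • B = M - P := by rw [hMd, hM, hP]; abel
  have hQQ : (M - P) * (M - P) = β • (M - P) := by
    rw [← hQ, smul_mul_smul_comm, hB, smul_smul]
  have key : M * P + P * M = M * M - β • M + (α + β) • P := by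
    simp only [mul_sub, sub_mul, hPP] at hQQ
    linear_combination (norm := module) (-1 : K) • hQQ
  clear hP hQ hQQ hM hA hB
  rw [← Matrix.fromBlocks_toBlocks P, hMd] at key
  rw [← Matrix.fromBlocks_toBlocks P] at hPP
  generalize P.toBlocks₁₁ = a at *
  generalize P.toBlocks₁₂ = b at *
  generalize P.toBlocks₂₁ = c at *
  generalize P.toBlocks₂₂ = d at *
  simp only [Matrix.fromBlocks_multiply, Matrix.fromBlocks_smul, Matrix.fromBlocks_add,
    sub_eq_add_neg, Matrix.fromBlocks_neg, Matrix.fromBlocks_inj] at key hPP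
  obtain ⟨k1, -, -, k4⟩ := key
  obtain ⟨p1, -, -, p4⟩ := hPP
  obtain ⟨k, hk⟩ : ∃ k, k = -β / (α - β) := ⟨_, rfl⟩
  have hkδ : (α - β) * k = -β := by rw [hk]; field_simp
  have hk0 : k ≠ 0 := by rw [hk]; exact div_ne_zero (neg_ne_zero.mpr hβ) hδ
  have ha : a = α • 1 + k • N := by
    rw [← sub_eq_zero]
    apply aux_sylv (α - β) hδ N _ hN
    simp only [mul_add, add_mul, mul_sub, sub_mul, smul_mul_assoc, mul_smul_comm, hN, one_mul,
      mul_one, Matrix.zero_mul, Matrix.mul_zero, smul_zero, add_zero] at k1 ⊢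
    have e : ((α - β) * k) • N = (-β) • N := by rw [hkδ]
    linear_combination (norm := module) k1 - e
  have hd : d = k • N' := by
    rw [← sub_eq_zero]
    apply aux_sylv (β - α) (sub_ne_zero.mpr hαβ.symm) N' _ hN'
    simp only [mul_add, add_mul, mul_sub, sub_mul, smul_mul_assoc, mul_smul_comm, hN', one_mul,
      mul_one, Matrix.zero_mul, Matrix.mul_zero, smul_zero, add_zero, zero_add] at k4 ⊢
    have e : ((α - β) * k) • N' = (-β) • N' := by rw [hkδ]
    linear_combination (norm := module) k4 + e
  subst ha hd
  simp only [mul_add, add_mul, smul_mul_assoc, mul_smul_comm, hN, hN', one_mul,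
      mul_one, smul_zero, add_zero] at p1 p4
  have q1 : b * c = (-(α * k)) • N := by linear_combination (norm := module) p1
  have q4 : c * b = (α * k) • N' := by linear_combination (norm := module) p4
  have h0 : α * k ≠ 0 := mul_ne_zero hα hk0
  refine ⟨(-(α * k))⁻¹ • b, c, ?_, ?_⟩
  · rw [Matrix.smul_mul, q1, smul_smul, inv_mul_cancel₀ (neg_ne_zero.mpr h0), one_smul]
  · rw [Matrix.mul_smul, q4, smul_smul, inv_neg, neg_mul, inv_mul_cancel₀ h0, neg_smul, one_smul]
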